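/- Fix positive reals k1,…,k36. In the polynomial ring ℝ[x1,…,x25], the ideal generated by the 25 component polynomials f_1,…,f_25 of the mass action vector field of Net3 equals the ideal generated by the 18 binomials (k2+k3)x13 − k1·x1·x9, (k5+k6)x18 − k4·x2·x10, k3·x13 − k6·x18, (k8+k9)x14 − k7·x2·x3, (k17+k18)x20 − k16·x4·x11, k9·x14 − k18·x20, (k11+k12)x15 − k10·x2·x4, (k14+k15)x19 − k13·x5·x11, k12·x15 − k15·x19, (k20+k21)x16 − k19·x5·x6, (k29+k30)x22 − k28·x7·x11, k21·x16 − k30·x22, (k23+k24)x17 − k22·x5·x7, (k26+k27)x21 − k25·x8·x11, k24·x17 − k27·x21, (k32+k33)x23 − k31·x2·x8, (k35+k36)x24 − k34·x12·x25, k33·x23 − k36·x24; in particular Net3 has toric steady states for all positive rate constants. -/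

import Mathlib

/-- The `j`-th standard basis vector of `ℕ^25`. -/
def ee (j : Fin 25) : Fin 25 → ℕ := fun i => if i = j then 1 else 0

/-- The 12 motifs `A + B ⇄ C → D + B` of Net3, recorded as tuples `(A, B, C, D)`
(0-based species indices, so `Xⱼ` is index `j - 1`). -/
def motifs3 : Fin 12 → Fin 25 × Fin 25 × Fin 25 × Fin 25 :=
  ![(0, 8, 12, 1),
    (1, 9, 17, 0),
    (2, 1, 13, 3),
    (3, 1, 14, 4),
    (4, 10, 18, 3),
    (3, 10, 19, 2),
    (5, 4, 15, 6),
    (6, 4, 16, 7),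
    (7, 10, 20, 6),
    (6, 10, 21, 5),
    (1, 7, 22, 24),
    (24, 11, 23, 1)]

/-- Exponent vector of the source complex of the `i`-th reaction of Net3
(motif `i / 3`; reactions `A+B → C`, `C → A+B`, `C → D+B`). -/
def src3 (i : Fin 36) : Fin 25 → ℕ :=
  let m := motifs3 ⟨i.val / 3, by have := i.isLt; omega⟩
  if i.val % 3 = 0 then ee m.1 + ee m.2.1 else ee m.2.2.1

/-- Exponent vector of the product complex of the `i`-th reaction of Net3. -/
def tgt3 (i : Fin 36) : Fin 25 → ℕ :=
  let m := motifs3 ⟨i.val / 3, by have := i.isLt; omega⟩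
  if i.val % 3 = 0 then ee m.2.2.1
  else if i.val % 3 = 1 then ee m.1 + ee m.2.1
  else ee m.2.2.2 + ee m.2.1

open MvPolynomial

/-- The `j`-th component of the mass action vector field of Net3, as a polynomial in
`ℝ[x₁,…,x25]`. -/
noncomputable def massActionPoly3 (k : Fin 36 → ℝ) (j : Fin 25) :
    MvPolynomial (Fin 25) ℝ :=
  ∑ i : Fin 36,
    C (k i * ((tgt3 i j : ℝ) - (src3 i j : ℝ))) * ∏ l : Fin 25, X l ^ src3 i l

set_option linter.unusedSimpArgs false

theorem prod_ee (a : Fin 25) :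
    (∏ l : Fin 25, (X l : MvPolynomial (Fin 25) ℝ) ^ ee a l) = X a := by
  simp [ee, Finset.prod_ite_eq', pow_ite]

theorem prod_ee2 (a b : Fin 25) :
    (∏ l : Fin 25, (X l : MvPolynomial (Fin 25) ℝ) ^ (ee a + ee b) l) = X a * X b := by
  simp only [Pi.add_apply, pow_add, Finset.prod_mul_distrib, prod_ee]

noncomputable def gg (k : Fin 36 → ℝ) (m : Fin 12) : MvPolynomial (Fin 25) ℝ :=
  C (k (finProdFinEquiv (m, (1 : Fin 3))) + k (finProdFinEquiv (m, (2 : Fin 3)))) * X (motifs3 m).2.2.1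
    - C (k (finProdFinEquiv (m, (0 : Fin 3)))) * (X (motifs3 m).1 * X (motifs3 m).2.1)

noncomputable def hh (k : Fin 36 → ℝ) (m : Fin 12) : MvPolynomial (Fin 25) ℝ :=
  C (k (finProdFinEquiv (m, (2 : Fin 3)))) * X (motifs3 m).2.2.1

theorem src_0 (m : Fin 12) : src3 (finProdFinEquiv (m, (0 : Fin 3))) =
    ee (motifs3 m).1 + ee (motifs3 m).2.1 := by
  fin_cases m <;> rfl
theorem src_1 (m : Fin 12) : src3 (finProdFinEquiv (m, (1 : Fin 3))) = ee (motifs3 m).2.2.1 := by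
  fin_cases m <;> rfl
theorem src_2 (m : Fin 12) : src3 (finProdFinEquiv (m, (2 : Fin 3))) = ee (motifs3 m).2.2.1 := by
  fin_cases m <;> rfl
theorem tgt_0 (m : Fin 12) : tgt3 (finProdFinEquiv (m, (0 : Fin 3))) = ee (motifs3 m).2.2.1 := by
  fin_cases m <;> rfl
theorem tgt_1 (m : Fin 12) : tgt3 (finProdFinEquiv (m, (1 : Fin 3))) =
    ee (motifs3 m).1 + ee (motifs3 m).2.1 := by
  fin_cases m <;> rfl
theorem tgt_2 (m : Fin 12) : tgt3 (finProdFinEquiv (m, (2 : Fin 3))) =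
    ee (motifs3 m).2.2.2 + ee (motifs3 m).2.1 := by
  fin_cases m <;> rfl

theorem mass_eq (k : Fin 36 → ℝ) (j : Fin 25) : massActionPoly3 k j =
    ∑ m : Fin 12, (((ee (motifs3 m).1 j : ℝ) + (ee (motifs3 m).2.1 j : ℝ)
        - (ee (motifs3 m).2.2.1 j : ℝ)) • gg k m
      + ((ee (motifs3 m).2.2.2 j : ℝ) - (ee (motifs3 m).1 j : ℝ)) • hh k m) := by
  unfold massActionPoly3
  rw [← (finProdFinEquiv (m := 12) (n := 3)).sum_comp, Fintype.sum_prod_type]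
  refine Finset.sum_congr rfl fun m _ => ?_
  simp only [Fin.sum_univ_three, src_0, src_1, src_2, tgt_0, tgt_1, tgt_2, prod_ee2]
  simp only [prod_ee, gg, hh,
    MvPolynomial.smul_eq_C_mul, Pi.add_apply, Nat.cast_add, map_add, map_sub, map_mul]
  ring

theorem f_0 (k : Fin 36 → ℝ) : massActionPoly3 k 0 = 0 + gg k 0 - hh k 0 + hh k 1 := by
  rw [mass_eq]; simp [Fin.sum_univ_succ, motifs3, ee]; try ring
theorem f_1 (k : Fin 36 → ℝ) : massActionPoly3 k 1 = 0 + gg k 1 + gg k 2 + gg k 3 + gg k 10 + hh k 0 - hh k 1 - hh k 10 + hh k 11 := by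
  rw [mass_eq]; simp [Fin.sum_univ_succ, motifs3, ee]; try ring
theorem f_2 (k : Fin 36 → ℝ) : massActionPoly3 k 2 = 0 + gg k 2 - hh k 2 + hh k 5 := by
  rw [mass_eq]; simp [Fin.sum_univ_succ, motifs3, ee]; try ring
theorem f_3 (k : Fin 36 → ℝ) : massActionPoly3 k 3 = 0 + gg k 3 + gg k 5 + hh k 2 - hh k 3 + hh k 4 - hh k 5 := by
  rw [mass_eq]; simp [Fin.sum_univ_succ, motifs3, ee]; try ring
theorem f_4 (k : Fin 36 → ℝ) : massActionPoly3 k 4 = 0 + gg k 4 + gg k 6 + gg k 7 + hh k 3 - hh k 4 := by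
  rw [mass_eq]; simp [Fin.sum_univ_succ, motifs3, ee]; try ring
theorem f_5 (k : Fin 36 → ℝ) : massActionPoly3 k 5 = 0 + gg k 6 - hh k 6 + hh k 9 := by
  rw [mass_eq]; simp [Fin.sum_univ_succ, motifs3, ee]; try ring
theorem f_6 (k : Fin 36 → ℝ) : massActionPoly3 k 6 = 0 + gg k 7 + gg k 9 + hh k 6 - hh k 7 + hh k 8 - hh k 9 := by
  rw [mass_eq]; simp [Fin.sum_univ_succ, motifs3, ee]; try ring
theorem f_7 (k : Fin 36 → ℝ) : massActionPoly3 k 7 = 0 + gg k 8 + gg k 10 + hh k 7 - hh k 8 := by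
  rw [mass_eq]; simp [Fin.sum_univ_succ, motifs3, ee]; try ring
theorem f_8 (k : Fin 36 → ℝ) : massActionPoly3 k 8 = 0 + gg k 0 := by
  rw [mass_eq]; simp [Fin.sum_univ_succ, motifs3, ee]; try ring
theorem f_9 (k : Fin 36 → ℝ) : massActionPoly3 k 9 = 0 + gg k 1 := by
  rw [mass_eq]; simp [Fin.sum_univ_succ, motifs3, ee]; try ring
theorem f_10 (k : Fin 36 → ℝ) : massActionPoly3 k 10 = 0 + gg k 4 + gg k 5 + gg k 8 + gg k 9 := by
  rw [mass_eq]; simp [Fin.sum_univ_succ, motifs3, ee]; try ring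
theorem f_11 (k : Fin 36 → ℝ) : massActionPoly3 k 11 = 0 + gg k 11 := by
  rw [mass_eq]; simp [Fin.sum_univ_succ, motifs3, ee]; try ring
theorem f_12 (k : Fin 36 → ℝ) : massActionPoly3 k 12 = 0 - gg k 0 := by
  rw [mass_eq]; simp [Fin.sum_univ_succ, motifs3, ee]; try ring
theorem f_13 (k : Fin 36 → ℝ) : massActionPoly3 k 13 = 0 - gg k 2 := by
  rw [mass_eq]; simp [Fin.sum_univ_succ, motifs3, ee]; try ring
theorem f_14 (k : Fin 36 → ℝ) : massActionPoly3 k 14 = 0 - gg k 3 := by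
  rw [mass_eq]; simp [Fin.sum_univ_succ, motifs3, ee]; try ring
theorem f_15 (k : Fin 36 → ℝ) : massActionPoly3 k 15 = 0 - gg k 6 := by
  rw [mass_eq]; simp [Fin.sum_univ_succ, motifs3, ee]; try ring
theorem f_16 (k : Fin 36 → ℝ) : massActionPoly3 k 16 = 0 - gg k 7 := by
  rw [mass_eq]; simp [Fin.sum_univ_succ, motifs3, ee]; try ring
theorem f_17 (k : Fin 36 → ℝ) : massActionPoly3 k 17 = 0 - gg k 1 := by
  rw [mass_eq]; simp [Fin.sum_univ_succ, motifs3, ee]; try ring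
theorem f_18 (k : Fin 36 → ℝ) : massActionPoly3 k 18 = 0 - gg k 4 := by
  rw [mass_eq]; simp [Fin.sum_univ_succ, motifs3, ee]; try ring
theorem f_19 (k : Fin 36 → ℝ) : massActionPoly3 k 19 = 0 - gg k 5 := by
  rw [mass_eq]; simp [Fin.sum_univ_succ, motifs3, ee]; try ring
theorem f_20 (k : Fin 36 → ℝ) : massActionPoly3 k 20 = 0 - gg k 8 := by
  rw [mass_eq]; simp [Fin.sum_univ_succ, motifs3, ee]; try ring
theorem f_21 (k : Fin 36 → ℝ) : massActionPoly3 k 21 = 0 - gg k 9 := by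
  rw [mass_eq]; simp [Fin.sum_univ_succ, motifs3, ee]; try ring
theorem f_22 (k : Fin 36 → ℝ) : massActionPoly3 k 22 = 0 - gg k 10 := by
  rw [mass_eq]; simp [Fin.sum_univ_succ, motifs3, ee]; try ring
theorem f_23 (k : Fin 36 → ℝ) : massActionPoly3 k 23 = 0 - gg k 11 := by
  rw [mass_eq]; simp [Fin.sum_univ_succ, motifs3, ee]; try ring
theorem f_24 (k : Fin 36 → ℝ) : massActionPoly3 k 24 = 0 + gg k 11 + hh k 10 - hh k 11 := by
  rw [mass_eq]; simp [Fin.sum_univ_succ, motifs3, ee]; try ring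

theorem range_le (k : Fin 36 → ℝ) (I : Ideal (MvPolynomial (Fin 25) ℝ)) :
    Ideal.span (Set.range (massActionPoly3 k)) ≤ I ↔
      (∀ m, gg k m ∈ I) ∧ hh k 0 - hh k 1 ∈ I ∧ hh k 2 - hh k 5 ∈ I ∧ hh k 3 - hh k 4 ∈ I ∧ hh k 6 - hh k 9 ∈ I ∧ hh k 7 - hh k 8 ∈ I ∧ hh k 10 - hh k 11 ∈ I := by
  rw [Ideal.span_le, Set.range_subset_iff]
  simp only [SetLike.mem_coe, ← Ideal.Quotient.eq_zero_iff_mem]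
  constructor
  · intro H
    have e0 := H 0
    have e1 := H 1
    have e2 := H 2
    have e3 := H 3
    have e4 := H 4
    have e5 := H 5
    have e6 := H 6
    have e7 := H 7
    have e8 := H 8
    have e9 := H 9
    have e10 := H 10
    have e11 := H 11
    have e12 := H 12
    have e13 := H 13
    have e14 := H 14
    have e15 := H 15
    have e16 := H 16
    have e17 := H 17
    have e18 := H 18
    have e19 := H 19
    have e20 := H 20
    have e21 := H 21
    have e22 := H 22
    have e23 := H 23
    have e24 := H 24
    simp only [f_0, f_1, f_2, f_3, f_4, f_5, f_6, f_7, f_8, f_9, f_10, f_11, f_12, f_13, f_14, f_15, f_16, f_17, f_18, f_19, f_20, f_21, f_22, f_23, f_24, map_add, map_sub, map_zero] at e0 e1 e2 e3 e4 e5 e6 e7 e8 e9 e10 e11 e12 e13 e14 e15 e16 e17 e18 e19 e20 e21 e22 e23 e24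
    have q0 : Ideal.Quotient.mk I (gg k 0) = 0 := by linear_combination -e12
    have q1 : Ideal.Quotient.mk I (gg k 1) = 0 := by linear_combination -e17
    have q2 : Ideal.Quotient.mk I (gg k 2) = 0 := by linear_combination -e13
    have q3 : Ideal.Quotient.mk I (gg k 3) = 0 := by linear_combination -e14
    have q4 : Ideal.Quotient.mk I (gg k 4) = 0 := by linear_combination -e18
    have q5 : Ideal.Quotient.mk I (gg k 5) = 0 := by linear_combination -e19
    have q6 : Ideal.Quotient.mk I (gg k 6) = 0 := by linear_combination -e15
    have q7 : Ideal.Quotient.mk I (gg k 7) = 0 := by linear_combination -e16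
    have q8 : Ideal.Quotient.mk I (gg k 8) = 0 := by linear_combination -e20
    have q9 : Ideal.Quotient.mk I (gg k 9) = 0 := by linear_combination -e21
    have q10 : Ideal.Quotient.mk I (gg k 10) = 0 := by linear_combination -e22
    have q11 : Ideal.Quotient.mk I (gg k 11) = 0 := by linear_combination -e23
    refine ⟨fun m => by fin_cases m <;> assumption, ?_, ?_, ?_, ?_, ?_, ?_⟩ <;> rw [map_sub]
    · linear_combination -(e0 - q0)
    · linear_combination -(e2 - q2)
    · linear_combination (e4 - q4 - q6 - q7)
    · linear_combination -(e5 - q6)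
    · linear_combination (e7 - q8 - q10)
    · linear_combination (e24 - q11)
  · rintro ⟨q, p0, p1, p2, p3, p4, p5⟩ j
    rw [map_sub] at p0 p1 p2 p3 p4 p5
    fin_cases j
    · refine (congrArg _ (f_0 k)).trans ?_
      simp only [map_add, map_sub, map_zero]
      linear_combination q 0 - p0
    · refine (congrArg _ (f_1 k)).trans ?_
      simp only [map_add, map_sub, map_zero]
      linear_combination q 1 + q 2 + q 3 + q 10 + p0 - p5
    · refine (congrArg _ (f_2 k)).trans ?_
      simp only [map_add, map_sub, map_zero]
      linear_combination q 2 - p1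
    · refine (congrArg _ (f_3 k)).trans ?_
      simp only [map_add, map_sub, map_zero]
      linear_combination q 3 + q 5 + p1 - p2
    · refine (congrArg _ (f_4 k)).trans ?_
      simp only [map_add, map_sub, map_zero]
      linear_combination q 4 + q 6 + q 7 + p2
    · refine (congrArg _ (f_5 k)).trans ?_
      simp only [map_add, map_sub, map_zero]
      linear_combination q 6 - p3
    · refine (congrArg _ (f_6 k)).trans ?_
      simp only [map_add, map_sub, map_zero]
      linear_combination q 7 + q 9 + p3 - p4
    · refine (congrArg _ (f_7 k)).trans ?_
      simp only [map_add, map_sub, map_zero]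
      linear_combination q 8 + q 10 + p4
    · refine (congrArg _ (f_8 k)).trans ?_
      simp only [map_add, map_sub, map_zero]
      linear_combination q 0
    · refine (congrArg _ (f_9 k)).trans ?_
      simp only [map_add, map_sub, map_zero]
      linear_combination q 1
    · refine (congrArg _ (f_10 k)).trans ?_
      simp only [map_add, map_sub, map_zero]
      linear_combination q 4 + q 5 + q 8 + q 9
    · refine (congrArg _ (f_11 k)).trans ?_
      simp only [map_add, map_sub, map_zero]
      linear_combination q 11
    · refine (congrArg _ (f_12 k)).trans ?_
      simp only [map_add, map_sub, map_zero]
      linear_combination - q 0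
    · refine (congrArg _ (f_13 k)).trans ?_
      simp only [map_add, map_sub, map_zero]
      linear_combination - q 2
    · refine (congrArg _ (f_14 k)).trans ?_
      simp only [map_add, map_sub, map_zero]
      linear_combination - q 3
    · refine (congrArg _ (f_15 k)).trans ?_
      simp only [map_add, map_sub, map_zero]
      linear_combination - q 6
    · refine (congrArg _ (f_16 k)).trans ?_
      simp only [map_add, map_sub, map_zero]
      linear_combination - q 7
    · refine (congrArg _ (f_17 k)).trans ?_
      simp only [map_add, map_sub, map_zero]
      linear_combination - q 1
    · refine (congrArg _ (f_18 k)).trans ?_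
      simp only [map_add, map_sub, map_zero]
      linear_combination - q 4
    · refine (congrArg _ (f_19 k)).trans ?_
      simp only [map_add, map_sub, map_zero]
      linear_combination - q 5
    · refine (congrArg _ (f_20 k)).trans ?_
      simp only [map_add, map_sub, map_zero]
      linear_combination - q 8
    · refine (congrArg _ (f_21 k)).trans ?_
      simp only [map_add, map_sub, map_zero]
      linear_combination - q 9
    · refine (congrArg _ (f_22 k)).trans ?_
      simp only [map_add, map_sub, map_zero]
      linear_combination - q 10
    · refine (congrArg _ (f_23 k)).trans ?_
      simp only [map_add, map_sub, map_zero]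
      linear_combination - q 11
    · refine (congrArg _ (f_24 k)).trans ?_
      simp only [map_add, map_sub, map_zero]
      linear_combination q 11 + p5

/-- For every choice of positive rate constants, the steady state ideal of Net3 (the ideal
generated by the 25 components of the mass action vector field) equals the ideal generated
by the 18 binomials; in particular Net3 has toric steady states.
(Rate constant `kⱼ` of the paper is `k (j-1)` here, species `Xⱼ` is the variable `X (j-1)`.) -/
theorem net3_steady_state_ideal_is_binomial (k : Fin 36 → ℝ) (hk : ∀ i, 0 < k i) :
    Ideal.span (Set.range (massActionPoly3 k)) =
      Ideal.span
       ({C (k 1 + k 2) * X 12 - C (k 0) * (X 0 * X 8),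
        C (k 4 + k 5) * X 17 - C (k 3) * (X 1 * X 9),
        C (k 2) * X 12 - C (k 5) * X 17,
        C (k 7 + k 8) * X 13 - C (k 6) * (X 1 * X 2),
        C (k 16 + k 17) * X 19 - C (k 15) * (X 3 * X 10),
        C (k 8) * X 13 - C (k 17) * X 19,
        C (k 10 + k 11) * X 14 - C (k 9) * (X 1 * X 3),
        C (k 13 + k 14) * X 18 - C (k 12) * (X 4 * X 10),
        C (k 11) * X 14 - C (k 14) * X 18,
        C (k 19 + k 20) * X 15 - C (k 18) * (X 4 * X 5),
        C (k 28 + k 29) * X 21 - C (k 27) * (X 6 * X 10),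
        C (k 20) * X 15 - C (k 29) * X 21,
        C (k 22 + k 23) * X 16 - C (k 21) * (X 4 * X 6),
        C (k 25 + k 26) * X 20 - C (k 24) * (X 7 * X 10),
        C (k 23) * X 16 - C (k 26) * X 20,
        C (k 31 + k 32) * X 22 - C (k 30) * (X 1 * X 7),
        C (k 34 + k 35) * X 23 - C (k 33) * (X 11 * X 24),
        C (k 32) * X 22 - C (k 35) * X 23} : Set (MvPolynomial (Fin 25) ℝ)) := by
  refine eq_of_forall_ge_iff fun I => ?_
  rw [range_le, Ideal.span_le]
  simp only [Set.insert_subset_iff, Set.singleton_subset_iff, SetLike.mem_coe]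
  have c : X 11 * X 24 = (X 24 * X 11 : MvPolynomial (Fin 25) ℝ) := mul_comm _ _
  have c1 : X 1 * X 2 = (X 2 * X 1 : MvPolynomial (Fin 25) ℝ) := mul_comm _ _
  have c2 : X 1 * X 3 = (X 3 * X 1 : MvPolynomial (Fin 25) ℝ) := mul_comm _ _
  have c3 : X 4 * X 5 = (X 5 * X 4 : MvPolynomial (Fin 25) ℝ) := mul_comm _ _
  have c4 : X 4 * X 6 = (X 6 * X 4 : MvPolynomial (Fin 25) ℝ) := mul_comm _ _
  rw [c, c1, c2, c3, c4]
  constructor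
  · rintro ⟨q, p0, p1, p2, p3, p4, p5⟩
    exact ⟨q 0, q 1, p0, q 2, q 5, p1, q 3, q 4, p2, q 6, q 9, p3, q 7, q 8, p4, q 10, q 11, p5⟩
  · rintro ⟨q0, q1, p0, q2, q5, p1, q3, q4, p2, q6, q9, p3, q7, q8, p4, q10, q11, p5⟩
    exact ⟨fun m => by fin_cases m; exacts [q0, q1, q2, q3, q4, q5, q6, q7, q8, q9, q10, q11], p0, p1, p2, p3, p4, p5⟩
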